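/- The conjugated dispersion matrix M2 := Pbar·G·H·S2·F·P is anti-Hermitian: M2ᴴ = −M2. -/

import Mathlib

open Matrix Complex BigOperators

noncomputable section

/-- The shifted integer index `k̂ = k - N/2` associated to `k ∈ Fin N`. -/
def khat (N : ℕ) (k : Fin N) : ℤ := (k : ℤ) - (N : ℤ) / 2

/-- The collocation angles `θ_j = 2π ĵ / N`. -/
def theta (N : ℕ) (j : Fin N) : ℝ := 2 * Real.pi * (khat N j : ℝ) / N

/-- The discrete Fourier matrix `F`, `F_{k,j} = (1/N) exp(-i k̂ θ_j)`. -/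
def Fm (N : ℕ) : Matrix (Fin N) (Fin N) ℂ :=
  Matrix.of fun k j => (N : ℂ)⁻¹ * Complex.exp (-Complex.I * (khat N k : ℂ) * (theta N j : ℂ))

/-- The inverse discrete Fourier matrix `G`, `G_{j,k} = exp(i k̂ θ_j)`. -/
def Gm (N : ℕ) : Matrix (Fin N) (Fin N) ℂ :=
  Matrix.of fun j k => Complex.exp (Complex.I * (khat N k : ℂ) * (theta N j : ℂ))

/-- The diagonal weight matrix `P = diag(α - i x_j)`. -/
def Pm (N : ℕ) (α : ℝ) (x : Fin N → ℝ) : Matrix (Fin N) (Fin N) ℂ :=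
  Matrix.diagonal fun j => (α : ℂ) - Complex.I * (x j : ℂ)

/-- The diagonal matrix `P⁻¹ = diag((α - i x_j)⁻¹)`. -/
def PinvM (N : ℕ) (α : ℝ) (x : Fin N → ℝ) : Matrix (Fin N) (Fin N) ℂ :=
  Matrix.diagonal fun j => ((α : ℂ) - Complex.I * (x j : ℂ))⁻¹

/-- The diagonal matrix `P̄ = diag(α + i x_j)`. -/
def PbarM (N : ℕ) (α : ℝ) (x : Fin N → ℝ) : Matrix (Fin N) (Fin N) ℂ :=
  Matrix.diagonal fun j => (α : ℂ) + Complex.I * (x j : ℂ)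

/-- The discrete Hilbert transform matrix `H = diag(-i sgn(k̂))` with `sgn(0) = 1`. -/
def Hm (N : ℕ) : Matrix (Fin N) (Fin N) ℂ :=
  Matrix.diagonal fun k => if 0 ≤ khat N k then -Complex.I else Complex.I

/-- The tridiagonal differentiation matrix `S1`:
`(S1)_{k,k-1} = i k̂/(2α)`, `(S1)_{k,k} = i (2k̂+1)/(2α)`, `(S1)_{k,k+1} = i (k̂+1)/(2α)`. -/
def S1 (N : ℕ) (α : ℝ) : Matrix (Fin N) (Fin N) ℂ :=
  Matrix.of fun k l =>
    if (l : ℤ) = (k : ℤ) - 1 then Complex.I * (khat N k : ℂ) / (2 * (α : ℂ))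
    else if (l : ℤ) = (k : ℤ) then Complex.I * (2 * (khat N k : ℂ) + 1) / (2 * (α : ℂ))
    else if (l : ℤ) = (k : ℤ) + 1 then Complex.I * ((khat N k : ℂ) + 1) / (2 * (α : ℂ))
    else 0

/-- The second-derivative matrix `S2 = S1 · S1`. -/
def S2 (N : ℕ) (α : ℝ) : Matrix (Fin N) (Fin N) ℂ := S1 N α * S1 N α

/-- The discrete inner product `⟨u,v⟩_h = (π/(Nα)) Σ_j (α² + x_j²) u_j conj(v_j)`. -/
def iph (N : ℕ) (α : ℝ) (x : Fin N → ℝ) (u v : Fin N → ℂ) : ℂ :=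
  ((Real.pi / (N * α) : ℝ) : ℂ) *
    ∑ j, ((α ^ 2 + x j ^ 2 : ℝ) : ℂ) * u j * (starRingEnd ℂ) (v j)

/-- The conjugated first-derivative operator `B_{S1} = P⁻¹ G S1 F P`. -/
def BS1 (N : ℕ) (α : ℝ) (x : Fin N → ℝ) : Matrix (Fin N) (Fin N) ℂ :=
  PinvM N α x * Gm N * S1 N α * Fm N * Pm N α x

/-- The conjugated operator `B_{HS1} = P⁻¹ G H S1 F P`. -/
def BHS1 (N : ℕ) (α : ℝ) (x : Fin N → ℝ) : Matrix (Fin N) (Fin N) ℂ :=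
  PinvM N α x * Gm N * Hm N * S1 N α * Fm N * Pm N α x

/-- The conjugated dispersion operator `B_{HS2} = P⁻¹ G H S2 F P`. -/
def BHS2 (N : ℕ) (α : ℝ) (x : Fin N → ℝ) : Matrix (Fin N) (Fin N) ℂ :=
  PinvM N α x * Gm N * Hm N * S2 N α * Fm N * Pm N α x

/-- Coercion of a real vector into a complex vector. -/
def cv (N : ℕ) (u : Fin N → ℝ) : Fin N → ℂ := fun j => (u j : ℂ)

/-- Entrywise `m`-th power of a complex vector. -/
def pw (N : ℕ) (m : ℕ) (u : Fin N → ℂ) : Fin N → ℂ := fun j => u j ^ m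

/-- The mass-conservative semi-discrete right-hand side
`f_M(w) = B_{HS2} w - (1/(m+1)) (w^{∘(m-1)} ⊙ (B_{S1} w) + B_{S1}(w^{∘m}))`. -/
def fM (N : ℕ) (α : ℝ) (x : Fin N → ℝ) (m : ℕ) (w : Fin N → ℂ) : Fin N → ℂ :=
  fun j => (BHS2 N α x *ᵥ w) j
    - (1 / ((m : ℂ) + 1)) *
        ((w j) ^ (m - 1) * (BS1 N α x *ᵥ w) j + (BS1 N α x *ᵥ pw N m w) j)

/-- The energy-conservative semi-discrete right-hand side
`f_E(w) = -B_{S1}(-B_{HS1} w + (1/m) w^{∘m})`. -/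
def fE (N : ℕ) (α : ℝ) (x : Fin N → ℝ) (m : ℕ) (w : Fin N → ℂ) : Fin N → ℂ :=
  -(BS1 N α x *ᵥ (-(BHS1 N α x *ᵥ w) + (1 / (m : ℂ)) • pw N m w))

/-- The semi-discrete energy
`E_h(w) = (1/2)⟨B_{HS1} w, w⟩_h - (1/(m(m+1)))⟨w^{∘m}, w⟩_h`. -/
def Eh (N : ℕ) (α : ℝ) (x : Fin N → ℝ) (m : ℕ) (w : Fin N → ℂ) : ℂ :=
  (1 / 2 : ℂ) * iph N α x (BHS1 N α x *ᵥ w) w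
    - (1 / ((m : ℂ) * ((m : ℂ) + 1))) * iph N α x (pw N m w) w

end

theorem Pm_conjTranspose (N : ℕ) (α : ℝ) (x : Fin N → ℝ) : (Pm N α x)ᴴ = PbarM N α x := by
  simp [Pm, PbarM, diagonal_conjTranspose, Pi.star_def]

theorem PbarM_conjTranspose (N : ℕ) (α : ℝ) (x : Fin N → ℝ) : (PbarM N α x)ᴴ = Pm N α x := by
  rw [← Pm_conjTranspose, conjTranspose_conjTranspose]

theorem Fm_conjTranspose (N : ℕ) : (Fm N)ᴴ = (N : ℂ)⁻¹ • Gm N := by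
  ext j k
  simp [Fm, Gm, ← Complex.exp_conj]

theorem Gm_conjTranspose {N : ℕ} (hN : N ≠ 0) : (Gm N)ᴴ = (N : ℂ) • Fm N := by
  have hN' : (N : ℂ) ≠ 0 := Nat.cast_ne_zero.mpr hN
  rw [← conjTranspose_conjTranspose (Fm N), Fm_conjTranspose, conjTranspose_smul, smul_smul]
  simp [hN']

theorem Hm_conjTranspose (N : ℕ) : (Hm N)ᴴ = -Hm N := by
  rw [Hm, diagonal_conjTranspose, diagonal_neg]
  congr 1
  ext k
  by_cases h : 0 ≤ khat N k <;> simp [h]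

theorem S1_conjTranspose (N : ℕ) (α : ℝ) : (S1 N α)ᴴ = -S1 N α := by
  ext k l
  have hkl : (khat N l : ℂ) - (l : ℤ) = khat N k - (k : ℤ) := by
    simp [khat]
  simp only [conjTranspose_apply, Matrix.neg_apply, S1, of_apply]
  by_cases h1 : (l : ℤ) = k - 1
  · have : (khat N k : ℂ) = khat N l + 1 := by
      rw [h1] at hkl
      push_cast at hkl
      linear_combination -hkl
    rw [if_neg (by lia), if_neg (by lia), if_pos (by lia), if_pos h1, this]
    simp [neg_div]
  by_cases h2 : (l : ℤ) = k
  · obtain rfl : l = k := Fin.ext (by exact_mod_cast h2)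
    rw [if_neg h1, if_pos rfl]
    simp [neg_div]
  by_cases h3 : (l : ℤ) = k + 1
  · have : (khat N l : ℂ) = khat N k + 1 := by
      rw [h3] at hkl
      push_cast at hkl
      linear_combination hkl
    rw [if_pos (by lia), if_neg h1, if_neg h2, if_pos h3, this]
    simp [neg_div]
  rw [if_neg (by lia), if_neg (by lia), if_neg (by lia), if_neg h1, if_neg h2, if_neg h3]
  simp

/-- `S1` does not couple nonnegative and negative frequencies. -/
theorem commute_Hm_S1 (N : ℕ) (α : ℝ) : Commute (Hm N) (S1 N α) := by
  ext k l
  rw [Hm, diagonal_mul, mul_diagonal, mul_comm]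
  by_cases h : 0 ≤ khat N k ↔ 0 ≤ khat N l
  · simp only [h]
  · have h0 : S1 N α k l = 0 := by
      simp only [S1, of_apply]
      split_ifs with h1 h2 h3
      · have : khat N k = 0 := by simp only [khat] at h ⊢; lia
        simp [this]
      · simp only [khat] at h; lia
      · have : khat N k = -1 := by simp only [khat] at h ⊢; lia
        simp [this]
      · rfl
    simp [h0]

theorem Hm_mul_S2_conjTranspose (N : ℕ) (α : ℝ) : (Hm N * S2 N α)ᴴ = -(Hm N * S2 N α) := by
  have h : Commute (Hm N) (S2 N α) := (commute_Hm_S1 N α).mul_right (commute_Hm_S1 N α)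
  have hS : (S2 N α)ᴴ = S2 N α := by
    rw [S2, conjTranspose_mul, S1_conjTranspose, neg_mul_neg]
  rw [conjTranspose_mul, Hm_conjTranspose, hS, mul_neg, h.eq]

/-- The conjugated dispersion matrix `M2 = P̄ G H S2 F P` is anti-Hermitian. -/
theorem M2_antiHermitian (N : ℕ) (hN : Even N) (hN0 : 0 < N)
    (α : ℝ) (hα : 0 < α) (x : Fin N → ℝ) :
    (PbarM N α x * Gm N * Hm N * S2 N α * Fm N * Pm N α x)ᴴ
      = -(PbarM N α x * Gm N * Hm N * S2 N α * Fm N * Pm N α x) := by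
  rw [Matrix.mul_assoc (PbarM N α x * Gm N)]
  simp only [conjTranspose_mul (_ * _) (Pm N α x), conjTranspose_mul _ (Fm N),
    conjTranspose_mul (PbarM N α x * Gm N), conjTranspose_mul (PbarM N α x) (Gm N),
    Pm_conjTranspose, PbarM_conjTranspose, Fm_conjTranspose, Gm_conjTranspose hN0.ne',
    Hm_mul_S2_conjTranspose]
  have hN' : (N : ℂ) ≠ 0 := Nat.cast_ne_zero.mpr hN0.ne'
  simp [Matrix.mul_assoc, smul_smul, hN']
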